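/- Let p, q, r be nonnegative integers. There exist a constant C > 0, a real ε > 0 and a natural number N (all depending only on p, q and r) such that the following holds: for every n ≥ N and every strictly increasing sequence of real numbers x_1 < x_2 < … < x_n with ∑_{k=1}^n x_k = 0, ∑_{k=1}^n x_k^2 = 1 and ∑_{k=1}^n |x_k|^3 ≤ ε, and for every t ∈ ℝ, one has |t^p ∂_t^q( (1/√(2π)) He_r(t) e^{−t²/2} − ∑_{k=1}^n (x_k − t/n)_+^{n−2−r} / ∏_{j≠k}(x_k − x_j) )| ≤ C ∑_{k=1}^n |x_k|^3. -/

import Mathlib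

open Real Finset

section

open Complex MeasureTheory Filter Topology

lemma add_I_mul_ne_zero {A : ℝ} (hA : A ≠ 0) (y : ℝ) : (A : ℂ) + I * y ≠ 0 := by
  intro h
  simpa [hA] using congrArg Complex.re h

lemma inv_sq_norm_add_I_mul_le {A a : ℝ} (hA : 0 < A) (ha : a ≠ 0) (u : ℝ) :
    (‖(A : ℂ) + I * ((u * a : ℝ) : ℂ)‖ ^ 2)⁻¹ ≤ (1 / A ^ 2 + 1 / a ^ 2) * (1 + u ^ 2)⁻¹ := by
  have h : ‖(A : ℂ) + I * ((u * a : ℝ) : ℂ)‖ ^ 2 = A ^ 2 + (u * a) ^ 2 := by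
    rw [← Complex.normSq_eq_norm_sq, Complex.normSq_apply]; simp; ring
  rw [h, inv_le_iff_one_le_mul₀ (by positivity), mul_assoc, ← div_eq_inv_mul, ← mul_div_assoc,
    one_le_div (by positivity)]
  have e : (1 / A ^ 2 + 1 / a ^ 2) * (A ^ 2 + (u * a) ^ 2)
      = 1 + u ^ 2 + (A ^ 2 / a ^ 2 + (u * a) ^ 2 / A ^ 2) := by
    field_simp
    ring
  rw [e]
  have : 0 ≤ A ^ 2 / a ^ 2 + (u * a) ^ 2 / A ^ 2 := by positivity
  linarith

lemma integrable_inv_mul_inv {A B a β : ℝ} (hA : 0 < A) (hB : 0 < B) (ha : a ≠ 0) (hβ : β ≠ 0) :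
    Integrable fun u : ℝ =>
      ((A : ℂ) + I * ((u * a : ℝ) : ℂ))⁻¹ * ((B : ℂ) + I * ((u * β : ℝ) : ℂ))⁻¹ := by
  refine Integrable.mono' (g := fun u : ℝ =>
    ((1 / A ^ 2 + 1 / a ^ 2) + (1 / B ^ 2 + 1 / β ^ 2)) * (1 + u ^ 2)⁻¹)
    (integrable_inv_one_add_sq.const_mul _) ?_ (Eventually.of_forall fun u => ?_)
  · refine Continuous.aestronglyMeasurable ?_
    exact (Continuous.inv₀ (by fun_prop) fun u => add_I_mul_ne_zero hA.ne' _).mul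
      (Continuous.inv₀ (by fun_prop) fun u => add_I_mul_ne_zero hB.ne' _)
  · have h1 := inv_sq_norm_add_I_mul_le hA ha u
    have h2 := inv_sq_norm_add_I_mul_le hB hβ u
    rw [norm_mul, norm_inv, norm_inv]
    rw [← inv_pow] at h1 h2
    nlinarith [sq_nonneg (‖(A : ℂ) + I * ((u * a : ℝ) : ℂ)‖⁻¹ -
      ‖(B : ℂ) + I * ((u * β : ℝ) : ℂ)‖⁻¹), sq_nonneg (‖(A : ℂ) + I * ((u * a : ℝ) : ℂ)‖⁻¹ +
      ‖(B : ℂ) + I * ((u * β : ℝ) : ℂ)‖⁻¹)]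

lemma tendsto_log_add_I_mul_sub_log {A a : ℝ} (ha : a ≠ 0) :
    Tendsto (fun u : ℝ => Complex.log ((A : ℂ) + I * ((u * a : ℝ) : ℂ)) - (Real.log u : ℂ)) atTop
      (𝓝 (Complex.log (I * a))) := by
  have h1 : Tendsto (fun u : ℝ => ((A * u⁻¹ : ℝ) : ℂ) + I * a) atTop (𝓝 (I * a)) := by
    have : Tendsto (fun u : ℝ => ((A * u⁻¹ : ℝ) : ℂ)) atTop (𝓝 ((A * 0 : ℝ) : ℂ)) :=
      (Complex.continuous_ofReal.tendsto _).comp (tendsto_inv_atTop_zero.const_mul A)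
    simpa using this.add_const (I * (a : ℂ))
  have h2 : I * (a : ℂ) ∈ slitPlane := by
    rw [mem_slitPlane_iff]; right; simpa using ha
  refine (h1.clog h2).congr' ?_
  filter_upwards [eventually_gt_atTop 0] with u hu
  have hne : ((A * u⁻¹ : ℝ) : ℂ) + I * a ≠ 0 := by
    intro h
    have := congrArg Complex.im h
    simp at this
    exact ha this
  have : (A : ℂ) + I * ((u * a : ℝ) : ℂ) = (u : ℂ) * (((A * u⁻¹ : ℝ) : ℂ) + I * a) := by
    have : (u : ℂ) ≠ 0 := by exact_mod_cast hu.ne'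
    push_cast
    field_simp
  rw [this, Complex.log_ofReal_mul hu hne]
  ring

lemma log_I_mul_sub_log_neg {a : ℝ} (ha : a ≠ 0) :
    Complex.log (I * a) - Complex.log (I * ((-a : ℝ) : ℂ)) = I * π * (if 0 < a then 1 else -1) := by
  have key : ∀ c : ℝ, 0 < c →
      Complex.log (I * c) - Complex.log (I * ((-c : ℝ) : ℂ)) = I * π := by
    intro c hc
    have e1 : I * (c : ℂ) = (c : ℂ) * I := mul_comm _ _
    have e2 : I * ((-c : ℝ) : ℂ) = (c : ℂ) * (-I) := by push_cast; ring
    rw [e1, e2, Complex.log_ofReal_mul hc I_ne_zero,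
      Complex.log_ofReal_mul hc (neg_ne_zero.2 I_ne_zero), Complex.log_I, Complex.log_neg_I]
    ring
  rcases ha.lt_or_gt with h | h
  · have := key (-a) (by linarith)
    rw [neg_neg] at this
    rw [if_neg (by linarith)]
    linear_combination -this
  · rw [if_pos h, key a h, mul_one]

lemma integral_inv_mul_inv {A B a β : ℝ} (hA : 0 < A) (hB : 0 < B) (ha : a ≠ 0) (hβ : β < 0)
    (hD : a * B - A * β ≠ 0) :
    ∫ u : ℝ, ((A : ℂ) + I * ((u * a : ℝ) : ℂ))⁻¹ * ((B : ℂ) + I * ((u * β : ℝ) : ℂ))⁻¹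
      = 2 * π * (if 0 < a then 1 else 0) / ((a * B - A * β : ℝ) : ℂ) := by
  have hDc : ((a * B - A * β : ℝ) : ℂ) ≠ 0 := by exact_mod_cast hD
  have hder : ∀ (A a : ℝ), 0 < A → ∀ u : ℝ,
      HasDerivAt (fun u : ℝ => Complex.log ((A : ℂ) + I * ((u * a : ℝ) : ℂ)))
        (((A : ℂ) + I * ((u * a : ℝ) : ℂ))⁻¹ * (I * a)) u := by
    intro A a hA u
    have h1 : HasDerivAt (fun u : ℝ => (A : ℂ) + I * ((u * a : ℝ) : ℂ)) (I * a) u := by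
      have := (((hasDerivAt_id u).mul_const a).ofReal_comp.const_mul I).const_add (A : ℂ)
      simpa using this
    have := h1.clog_real (by rw [mem_slitPlane_iff]; left; simpa using hA)
    rwa [div_eq_inv_mul] at this
  set f : ℝ → ℂ := fun u => -I / ((a * B - A * β : ℝ) : ℂ) *
    (Complex.log ((A : ℂ) + I * ((u * a : ℝ) : ℂ)) -
      Complex.log ((B : ℂ) + I * ((u * β : ℝ) : ℂ))) with hf
  have htop : ∀ (a β : ℝ), a ≠ 0 → β ≠ 0 → Tendsto (fun u : ℝ =>
      Complex.log ((A : ℂ) + I * ((u * a : ℝ) : ℂ)) -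
      Complex.log ((B : ℂ) + I * ((u * β : ℝ) : ℂ))) atTop
      (𝓝 (Complex.log (I * a) - Complex.log (I * β))) := by
    intro a β ha hβ
    refine ((tendsto_log_add_I_mul_sub_log (A := A) ha).sub
      (tendsto_log_add_I_mul_sub_log (A := B) hβ)).congr fun u => ?_
    ring
  have hbot : Tendsto (fun u : ℝ =>
      Complex.log ((A : ℂ) + I * ((u * a : ℝ) : ℂ)) -
      Complex.log ((B : ℂ) + I * ((u * β : ℝ) : ℂ))) atBot
      (𝓝 (Complex.log (I * ((-a : ℝ) : ℂ)) - Complex.log (I * ((-β : ℝ) : ℂ)))) := by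
    refine ((htop (-a) (-β) (neg_ne_zero.2 ha) (neg_ne_zero.2 hβ.ne)).comp
      tendsto_neg_atBot_atTop).congr fun u => ?_
    simp
  rw [integral_of_hasDerivAt_of_tendsto (f := f) (fun u => ?_)
    (integrable_inv_mul_inv hA hB ha hβ.ne) (hbot.const_mul _) ((htop a β ha hβ.ne).const_mul _)]
  · have e1 := log_I_mul_sub_log_neg ha
    have e2 := log_I_mul_sub_log_neg hβ.ne
    rw [if_neg (by linarith)] at e2
    rw [← mul_sub]
    have : Complex.log (I * a) - Complex.log (I * β) -
        (Complex.log (I * ((-a : ℝ) : ℂ)) - Complex.log (I * ((-β : ℝ) : ℂ)))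
        = 2 * I * π * (if 0 < a then 1 else 0) := by
      split_ifs at e1 ⊢ <;> linear_combination e1 - e2
    rw [this]
    field_simp
    rw [I_sq]; ring
  · have h := ((hder A a hA u).sub (hder B β hB u)).const_mul (-I / ((a * B - A * β : ℝ) : ℂ))
    refine h.congr_deriv ?_
    have n1 := add_I_mul_ne_zero hA.ne' (u * a)
    have n2 := add_I_mul_ne_zero hB.ne' (u * β)
    rw [div_mul_eq_mul_div, div_eq_iff hDc, ← mul_inv,
      inv_mul_eq_div, inv_mul_eq_div, div_sub_div _ _ n1 n2, inv_mul_eq_div, mul_div_assoc']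
    congr 1
    push_cast
    linear_combination (-(a * (B + I * (u * β))) + (A + I * (u * a)) * β : ℂ) * I_sq

variable {ι : Type*} [Fintype ι]

lemma neg_I_mul_pow_mul_prod_inv_eq_sum [DecidableEq ι]
    {a : ι → ℂ} (ha : Function.Injective a) {m r : ℕ}
    (hcard : m + r + 2 = Fintype.card ι) {w β : ℂ} (hw : w ≠ 0) (hβ : 1 + I * w * β ≠ 0)
    (hne : ∀ k, 1 + I * w * a k ≠ 0) :
    (-I * w) ^ r * ∏ k, (1 + I * w * a k)⁻¹ =
      ∑ k, a k ^ m * (a k - β) / (∏ j ∈ univ.erase k, (a k - a j)) *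
        ((1 + I * w * a k)⁻¹ * (1 + I * w * β)⁻¹) := by
  set ζ : ℂ := I / w with hζ
  have hζ0 : ζ ≠ 0 := div_ne_zero I_ne_zero hw
  have hsub : ∀ c : ℂ, ζ - c = ζ * (1 + I * w * c) := by
    intro c
    rw [hζ]
    field_simp
    linear_combination (-w * c) * I_sq
  have hwζ : -I * w = ζ⁻¹ := by
    rw [hζ, inv_div, div_eq_mul_inv, Complex.inv_I]; ring
  have hdeg : ((Polynomial.X ^ m * (Polynomial.X - Polynomial.C β) : Polynomial ℂ)).degree
      < #(univ : Finset ι) := by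
    rw [Polynomial.degree_mul, Polynomial.degree_X_pow, Polynomial.degree_X_sub_C, card_univ,
      ← hcard]
    norm_cast
    omega
  have hint := congrArg (Polynomial.eval ζ) (Lagrange.eq_interpolate ha.injOn hdeg)
  rw [Lagrange.eval_interpolate_not_at_node _ (fun i _ => by
    rw [← sub_ne_zero, hsub]; exact mul_ne_zero hζ0 (hne i)), Lagrange.eval_nodal] at hint
  simp only [Polynomial.eval_mul, Polynomial.eval_pow, Polynomial.eval_X, Polynomial.eval_sub,
    Polynomial.eval_C, hsub, prod_mul_distrib, prod_const, card_univ, ← hcard, mul_inv,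
    Lagrange.nodalWeight] at hint
  set Q := ∏ k, (1 + I * w * a k) with hQ
  have hQ0 : Q ≠ 0 := prod_ne_zero_iff.2 fun k _ => hne k
  set S := ∑ k, a k ^ m * (a k - β) / (∏ j ∈ univ.erase k, (a k - a j)) * (1 + I * w * a k)⁻¹
    with hS
  have hsum : ∑ k, (∏ j ∈ univ.erase k, (a k - a j)⁻¹) * (ζ⁻¹ * (1 + I * w * a k)⁻¹) *
      (a k ^ m * (a k - β)) = ζ⁻¹ * S := by
    rw [hS, mul_sum]
    refine sum_congr rfl fun k _ => ?_
    rw [prod_inv_distrib]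
    ring
  have hint' : ζ ^ m * (ζ * (1 + I * w * β)) = ζ ^ (m + r + 2) * Q * (ζ⁻¹ * S) := by
    rw [← hsum]
    exact hint
  have key : 1 + I * w * β = ζ ^ r * Q * S := by
    have : ζ ^ (m + 1) * (1 + I * w * β) = ζ ^ (m + 1) * (ζ ^ r * Q * S) := by
      rw [pow_succ, mul_assoc, hint']
      field_simp
      ring
    exact mul_left_cancel₀ (pow_ne_zero _ hζ0) this
  simp_rw [← mul_assoc, ← sum_mul]
  rw [← hS, prod_inv_distrib, ← hQ, hwζ, eq_mul_inv_iff_mul_eq₀ hβ, key, inv_pow]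
  field_simp

lemma one_add_I_mul_line (u b c : ℝ) :
    1 + I * ((u : ℂ) + b * I) * c = ((1 - b * c : ℝ) : ℂ) + I * ((u * c : ℝ) : ℂ) := by
  push_cast
  linear_combination (b * c : ℂ) * I_sq

lemma line_ne_zero {b : ℝ} (hb : b ≠ 0) (u : ℝ) : (u : ℂ) + b * I ≠ 0 := by
  intro h
  simpa [hb] using congrArg Complex.im h

/-- Contour-integral representation of a divided difference of a truncated power. -/
lemma integral_prod_inv_eq_sum_truncatedPower [DecidableEq ι]
    {a : ι → ℝ} (ha : Function.Injective a) {m r : ℕ}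
    (hcard : m + r + 2 = Fintype.card ι) (hm : m ≠ 0) {b : ℝ} (hb : b ^ 2 = 1)
    (hba : ∀ k, |a k| ≤ 1 / 4) :
    Integrable (fun u : ℝ => (-I * ((u : ℂ) + b * I)) ^ r *
        ∏ k, (1 + I * ((u : ℂ) + b * I) * a k)⁻¹) ∧
    ∫ u : ℝ, (-I * ((u : ℂ) + b * I)) ^ r * ∏ k, (1 + I * ((u : ℂ) + b * I) * a k)⁻¹ =
      2 * π * ((∑ k, max (a k) 0 ^ m / ∏ j ∈ univ.erase k, (a k - a j) : ℝ) : ℂ) := by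
  have hb0 : b ≠ 0 := by rintro rfl; norm_num at hb
  have hb1 : |b| ≤ 1 := by rw [← sq_le_one_iff_abs_le_one, hb]
  have hpos : ∀ c : ℝ, |c| ≤ 1 / 2 → 0 < 1 - b * c := by
    intro c hc
    have : |b * c| ≤ 1 * (1 / 2) := by rw [abs_mul]; gcongr
    linarith [le_abs_self (b * c)]
  have hA : ∀ k, 0 < 1 - b * a k := fun k => hpos _ ((hba k).trans (by norm_num))
  have hB : 0 < 1 - b * (-1 / 2 : ℝ) := hpos _ (by rw [abs_le]; constructor <;> norm_num)
  have hne : ∀ (u c : ℝ), 0 < 1 - b * c → 1 + I * ((u : ℂ) + b * I) * c ≠ 0 := by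
    intro u c hc h
    rw [one_add_I_mul_line] at h
    have := congrArg Complex.re h
    simp at this
    linarith
  have hfun : (fun u : ℝ => (-I * ((u : ℂ) + b * I)) ^ r *
      ∏ k, (1 + I * ((u : ℂ) + b * I) * a k)⁻¹) = fun u : ℝ =>
      ∑ k, ((a k ^ m * (a k - (-1 / 2)) / (∏ j ∈ univ.erase k, (a k - a j)) : ℝ) : ℂ) *
        ((((1 - b * a k : ℝ) : ℂ) + I * ((u * a k : ℝ) : ℂ))⁻¹ *
          (((1 - b * (-1 / 2) : ℝ) : ℂ) + I * ((u * (-1 / 2) : ℝ) : ℂ))⁻¹) := by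
    funext u
    rw [neg_I_mul_pow_mul_prod_inv_eq_sum (a := fun k => (a k : ℂ))
      (Complex.ofReal_injective.comp ha) hcard (line_ne_zero hb0 u) (hne u (-1 / 2) hB)
      (fun k => hne u _ (hA k))]
    refine sum_congr rfl fun k _ => ?_
    rw [one_add_I_mul_line, one_add_I_mul_line]
    push_cast
    rfl
  have hterm : ∀ k, Integrable (fun u : ℝ =>
      ((a k ^ m * (a k - (-1 / 2)) / (∏ j ∈ univ.erase k, (a k - a j)) : ℝ) : ℂ) *
        ((((1 - b * a k : ℝ) : ℂ) + I * ((u * a k : ℝ) : ℂ))⁻¹ *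
          (((1 - b * (-1 / 2) : ℝ) : ℂ) + I * ((u * (-1 / 2) : ℝ) : ℂ))⁻¹)) := by
    intro k
    rcases eq_or_ne (a k) 0 with h | h
    · simp [h, hm]
    · exact (integrable_inv_mul_inv (hA k) hB h (by norm_num)).const_mul _
  rw [hfun]
  refine ⟨integrable_finsetSum _ fun k _ => hterm k, ?_⟩
  rw [integral_finsetSum _ fun k _ => hterm k, Complex.ofReal_sum, mul_sum]
  refine sum_congr rfl fun k _ => ?_
  rcases eq_or_ne (a k) 0 with h | h
  · simp [h, hm]
  have hD : a k * (1 - b * (-1 / 2)) - (1 - b * a k) * (-1 / 2) = a k - (-1 / 2) := by ring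
  have hD0 : a k - (-1 / 2) ≠ 0 := by
    have := (abs_le.1 (hba k)).1
    linarith
  rw [integral_const_mul, integral_inv_mul_inv (hA k) hB h (by norm_num) (by rw [hD]; exact hD0),
    hD]
  have hD0' : ((a k - (-1 / 2) : ℝ) : ℂ) ≠ 0 := by exact_mod_cast hD0
  rcases h.lt_or_gt with h | h
  · rw [max_eq_right h.le, if_neg h.not_gt]; simp [hm]
  · rw [max_eq_left h.le, if_pos h, Complex.ofReal_div, Complex.ofReal_div, Complex.ofReal_mul]
    generalize ((a k - (-1 / 2) : ℝ) : ℂ) = d at *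
    field_simp

lemma exists_sign_mul_eq_abs (t : ℝ) : ∃ b : ℝ, b ^ 2 = 1 ∧ b * t = |t| := by
  rcases le_total 0 t with h | h
  · exact ⟨1, by norm_num, by rw [abs_of_nonneg h, one_mul]⟩
  · exact ⟨-1, by norm_num, by rw [abs_of_nonpos h]; ring⟩

lemma norm_line_le {b : ℝ} (hb : b ^ 2 = 1) (u : ℝ) : ‖(u : ℂ) + b * I‖ ≤ 1 + |u| := by
  have hb1 : |b| ≤ 1 := by rw [← sq_le_one_iff_abs_le_one, hb]
  refine (norm_add_le _ _).trans ?_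
  simp only [norm_real, Complex.norm_mul, norm_I, Real.norm_eq_abs]
  linarith

lemma two_add_abs_pow_mul_inv_le (k : ℕ) (u : ℝ) :
    (2 + |u|) ^ k * ((1 + u ^ 2 / (8 * (k + 1))) ^ (k + 1))⁻¹ ≤
      (16 * (k + 1)) ^ k * (8 * (k + 1)) * (1 + u ^ 2)⁻¹ := by
  have hk : (0 : ℝ) ≤ k := k.cast_nonneg
  set v := 1 + u ^ 2 / (8 * (k + 1)) with hv
  have hv0 : 0 < v := by positivity
  have h8 : 8 * (k + 1) * v = 8 * (k + 1) + u ^ 2 := by rw [hv]; field_simp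
  have h1 : (2 + |u|) ^ k ≤ (16 * (k + 1) * v) ^ k := by
    gcongr
    have : (2 + |u|) ^ 2 ≤ 16 * (k + 1) * v := by
      have : 16 * (k + 1) * v = 2 * (8 * (k + 1) * v) := by ring
      rw [this, h8]
      nlinarith [sq_nonneg (2 - |u|), sq_abs u]
    nlinarith [abs_nonneg u]
  have h2 : v⁻¹ ≤ 8 * (k + 1) * (1 + u ^ 2)⁻¹ := by
    rw [inv_le_iff_one_le_mul₀ hv0, mul_right_comm, h8, ← div_eq_mul_inv,
      one_le_div (by positivity)]
    linarith
  calc _ ≤ (16 * (k + 1) * v) ^ k * (v ^ (k + 1))⁻¹ := by gcongr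
    _ = (16 * (k + 1)) ^ k * v⁻¹ := by rw [mul_pow, pow_succ]; field_simp
    _ ≤ _ := by rw [mul_assoc]; gcongr

lemma norm_cexp_line_le {b t : ℝ} (hb : b ^ 2 = 1) (hbt : b * t = |t|) (k : ℕ) (u : ℝ) :
    ‖cexp (I * ((u : ℂ) + b * I) * t - ((u : ℂ) + b * I) ^ 2 / 2)‖ ≤
      Real.exp (1 - |t| / 2) * ((1 + u ^ 2 / (8 * (k + 1))) ^ (k + 1))⁻¹ := by
  have hre : (I * ((u : ℂ) + b * I) * t - ((u : ℂ) + b * I) ^ 2 / 2).re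
      = -(b * t) - (u ^ 2 - b ^ 2) / 2 := by
    simp [pow_two]
  have h1 : (1 + u ^ 2 / (8 * (k + 1))) ^ (k + 1) ≤ Real.exp (u ^ 2 / 8) := by
    calc (1 + u ^ 2 / (8 * (k + 1))) ^ (k + 1)
        ≤ Real.exp (u ^ 2 / (8 * (k + 1))) ^ (k + 1) := by
          gcongr; rw [add_comm]; exact Real.add_one_le_exp _
      _ = Real.exp (u ^ 2 / 8) := by
          rw [← Real.exp_nat_mul]; congr 1; push_cast; field_simp
  rw [Complex.norm_exp, hre, hbt, hb, ← div_eq_mul_inv, le_div_iff₀ (by positivity)]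
  calc _ ≤ Real.exp (-|t| - (u ^ 2 - 1) / 2) * Real.exp (u ^ 2 / 8) := by gcongr
    _ ≤ _ := by
      rw [← Real.exp_add]
      gcongr
      nlinarith [abs_nonneg t, sq_nonneg u]

lemma norm_pow_mul_cexp_line_le {b t : ℝ} (hb : b ^ 2 = 1) (hbt : b * t = |t|) (r : ℕ) (u : ℝ) :
    ‖(-I * ((u : ℂ) + b * I)) ^ r *
      cexp (I * ((u : ℂ) + b * I) * t - ((u : ℂ) + b * I) ^ 2 / 2)‖ ≤
      Real.exp (1 - |t| / 2) * ((16 * (r + 1)) ^ r * (8 * (r + 1)) * (1 + u ^ 2)⁻¹) := by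
  rw [norm_mul, norm_pow, norm_mul, norm_neg, norm_I, one_mul]
  calc _ ≤ (2 + |u|) ^ r *
        (Real.exp (1 - |t| / 2) * ((1 + u ^ 2 / (8 * (r + 1))) ^ (r + 1))⁻¹) := by
        gcongr
        · linarith [norm_line_le hb u]
        · exact norm_cexp_line_le hb hbt r u
    _ ≤ _ := by
        rw [mul_left_comm]
        exact mul_le_mul_of_nonneg_left (two_add_abs_pow_mul_inv_le r u) (Real.exp_pos _).le

lemma integrable_pow_mul_cexp_line {b t : ℝ} (hb : b ^ 2 = 1) (hbt : b * t = |t|) (r : ℕ) :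
    Integrable fun u : ℝ => (-I * ((u : ℂ) + b * I)) ^ r *
      cexp (I * ((u : ℂ) + b * I) * t - ((u : ℂ) + b * I) ^ 2 / 2) := by
  refine Integrable.mono' ((integrable_inv_one_add_sq.const_mul _).const_mul _)
    (by fun_prop) (Eventually.of_forall fun u => norm_pow_mul_cexp_line_le hb hbt r u)

lemma derivative_hermite_succ (n : ℕ) :
    Polynomial.derivative (Polynomial.hermite (n + 1)) =
      ((n + 1 : ℕ) : Polynomial ℤ) * Polynomial.hermite n := by
  induction n with
  | zero => simp
  | succ n ih =>
    rw [Polynomial.hermite_succ (n + 1), Polynomial.derivative_sub, Polynomial.derivative_mul, ih,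
      Polynomial.derivative_natCast_mul, Polynomial.derivative_X]
    have := Polynomial.hermite_succ n
    push_cast
    linear_combination (-(n + 1) : Polynomial ℤ) * this

/-- The normalised Hermite function `He_r(t) e^{-t²/2} / √(2π)`. -/
noncomputable def hermiteFun (r : ℕ) (t : ℝ) : ℝ :=
  (1 / Real.sqrt (2 * π)) * ((Polynomial.hermite r).map (Int.castRingHom ℝ)).eval t *
    Real.exp (-t ^ 2 / 2)

lemma hermiteFun_succ_succ (r : ℕ) (t : ℝ) :
    hermiteFun (r + 2) t = t * hermiteFun (r + 1) t - (r + 1) * hermiteFun r t := by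
  simp only [hermiteFun]
  rw [Polynomial.hermite_succ (r + 1), derivative_hermite_succ]
  simp
  ring

/-- Contour-integral representation of the Hermite function. -/
lemma integral_pow_mul_cexp_line {b t : ℝ} (hb : b ^ 2 = 1) (hbt : b * t = |t|) (r : ℕ) :
    ∫ u : ℝ, (-I * ((u : ℂ) + b * I)) ^ r *
      cexp (I * ((u : ℂ) + b * I) * t - ((u : ℂ) + b * I) ^ 2 / 2) =
      2 * π * (hermiteFun r t : ℂ) := by
  have hder : ∀ (r : ℕ) (u : ℝ), HasDerivAt (fun u : ℝ => (-I * ((u : ℂ) + b * I)) ^ r *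
      cexp (I * ((u : ℂ) + b * I) * t - ((u : ℂ) + b * I) ^ 2 / 2))
      (-I * (r * ((-I * ((u : ℂ) + b * I)) ^ (r - 1) *
        cexp (I * ((u : ℂ) + b * I) * t - ((u : ℂ) + b * I) ^ 2 / 2))
      - t * ((-I * ((u : ℂ) + b * I)) ^ r *
        cexp (I * ((u : ℂ) + b * I) * t - ((u : ℂ) + b * I) ^ 2 / 2))
      + (-I * ((u : ℂ) + b * I)) ^ (r + 1) *
        cexp (I * ((u : ℂ) + b * I) * t - ((u : ℂ) + b * I) ^ 2 / 2))) u := by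
    intro r u
    have hw : HasDerivAt (fun u : ℝ => (u : ℂ) + b * I) 1 u :=
      ((hasDerivAt_id u).ofReal_comp).add_const _
    have h := ((hw.const_mul (-I)).pow r).mul
      (((hw.const_mul I).mul_const (t : ℂ)).sub ((hw.pow 2).div_const 2)).cexp
    refine h.congr_deriv ?_
    simp only [Pi.pow_apply, Pi.sub_apply]
    generalize cexp _ = e
    generalize (u : ℂ) + b * I = w
    push_cast
    linear_combination (-(-I * w) ^ r * w * e) * I_sq
  have hrec : ∀ r : ℕ, (r : ℂ) * (∫ u : ℝ, (-I * ((u : ℂ) + b * I)) ^ (r - 1) *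
        cexp (I * ((u : ℂ) + b * I) * t - ((u : ℂ) + b * I) ^ 2 / 2))
      - t * (∫ u : ℝ, (-I * ((u : ℂ) + b * I)) ^ r *
        cexp (I * ((u : ℂ) + b * I) * t - ((u : ℂ) + b * I) ^ 2 / 2))
      + (∫ u : ℝ, (-I * ((u : ℂ) + b * I)) ^ (r + 1) *
        cexp (I * ((u : ℂ) + b * I) * t - ((u : ℂ) + b * I) ^ 2 / 2)) = 0 := by
    intro r
    have i1 := (integrable_pow_mul_cexp_line hb hbt (r - 1)).const_mul (r : ℂ)
    have i2 := (integrable_pow_mul_cexp_line hb hbt r).const_mul (t : ℂ)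
    have i3 := integrable_pow_mul_cexp_line hb hbt (r + 1)
    have := integral_eq_zero_of_hasDerivAt_of_integrable (hder r)
      (((i1.sub i2).add i3).const_mul (-I)) (integrable_pow_mul_cexp_line hb hbt r)
    have e1 := integral_add (i1.sub i2) i3
    have e2 := integral_sub i1 i2
    simp only [Pi.sub_apply] at e1
    rw [integral_const_mul, e1, e2, integral_const_mul, integral_const_mul] at this
    exact (mul_eq_zero.1 this).resolve_left (neg_ne_zero.2 I_ne_zero)
  have h0 : ∫ u : ℝ, (-I * ((u : ℂ) + b * I)) ^ 0 *
      cexp (I * ((u : ℂ) + b * I) * t - ((u : ℂ) + b * I) ^ 2 / 2) =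
      2 * π * (hermiteFun 0 t : ℂ) := by
    have e : ∀ u : ℝ, (-I * ((u : ℂ) + b * I)) ^ 0 *
      cexp (I * ((u : ℂ) + b * I) * t - ((u : ℂ) + b * I) ^ 2 / 2) =
      cexp ((-1 / 2) * (u : ℂ) ^ 2 + (I * (t - b)) * u + (b ^ 2 / 2 - b * t)) := by
      intro u
      rw [pow_zero, one_mul]
      congr 1
      linear_combination (b * t - b ^ 2 / 2 : ℂ) * I_sq
    simp_rw [e]
    rw [integral_cexp_quadratic (by norm_num)]
    have e2 : (b ^ 2 / 2 - b * t : ℂ) - (I * (t - b)) ^ 2 / (4 * (-1 / 2)) =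
        ((-t ^ 2 / 2 : ℝ) : ℂ) := by
      push_cast
      linear_combination ((t - b) ^ 2 / 2 : ℂ) * I_sq
    have e3 : (π / -(-1 / 2) : ℂ) ^ (1 / 2 : ℂ) = (Real.sqrt (2 * π) : ℂ) := by
      rw [Real.sqrt_eq_rpow, Complex.ofReal_cpow (by positivity)]
      push_cast
      congr 1
      ring
    rw [e2, e3, hermiteFun, ← Complex.ofReal_exp]
    have hs : (Real.sqrt (2 * π) : ℂ) * Real.sqrt (2 * π) = 2 * π := by
      rw [← Complex.ofReal_mul, Real.mul_self_sqrt (by positivity)]; simp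
    have hs0 : (Real.sqrt (2 * π) : ℂ) ≠ 0 := by
      exact_mod_cast (Real.sqrt_pos.2 (by positivity)).ne'
    rw [← hs]
    generalize Real.sqrt (2 * π) = c at *
    simp
    field_simp
  have h1 : ∫ u : ℝ, (-I * ((u : ℂ) + b * I)) ^ 1 *
      cexp (I * ((u : ℂ) + b * I) * t - ((u : ℂ) + b * I) ^ 2 / 2) =
      2 * π * (hermiteFun 1 t : ℂ) := by
    have := hrec 0
    rw [h0] at this
    have e : hermiteFun 1 t = t * hermiteFun 0 t := by simp [hermiteFun]; ring
    rw [e]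
    push_cast at this ⊢
    linear_combination this
  induction r using Nat.twoStepInduction with
  | zero => exact h0
  | one => exact h1
  | more r ih1 ih2 =>
    have := hrec (r + 1)
    rw [Nat.add_sub_cancel, ih1, ih2] at this
    rw [hermiteFun_succ_succ]
    push_cast at this ⊢
    linear_combination this

lemma abs_hermiteFun_le (r : ℕ) : ∃ C > 0, ∀ t : ℝ,
    |hermiteFun r t| ≤ C * Real.exp (-(|t| / 2)) := by
  refine ⟨Real.exp 1 * ((16 * (r + 1)) ^ r * (8 * (r + 1))), by positivity, fun t => ?_⟩
  obtain ⟨b, hb, hbt⟩ := exists_sign_mul_eq_abs t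
  have h := norm_integral_le_of_norm_le
    ((integrable_inv_one_add_sq.const_mul ((16 * (r + 1)) ^ r * (8 * (r + 1) : ℝ))).const_mul
      (Real.exp (1 - |t| / 2)))
    (Eventually.of_forall fun u => norm_pow_mul_cexp_line_le hb hbt r u)
  rw [integral_pow_mul_cexp_line hb hbt, integral_const_mul, integral_const_mul,
    integral_univ_inv_one_add_sq, norm_mul, norm_mul, norm_real, norm_real, Real.norm_eq_abs,
    Real.norm_eq_abs, abs_of_pos Real.pi_pos, Complex.norm_ofNat, sub_eq_add_neg,
    Real.exp_add] at h
  have hX : 0 ≤ Real.exp 1 * ((16 * (r + 1)) ^ r * (8 * (r + 1))) * Real.exp (-(|t| / 2)) := by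
    positivity
  nlinarith [Real.pi_pos]

lemma exp_neg_add_sq_le_one_sub {y : ℝ} (hy : |y| ≤ 1 / 4) :
    Real.exp (-(y + y ^ 2)) ≤ 1 - y := by
  obtain ⟨h1, h2⟩ := abs_le.1 hy
  rw [Real.exp_neg, inv_le_iff_one_le_mul₀ (Real.exp_pos _)]
  rcases le_total y 0 with h | h
  · nlinarith [Real.add_one_le_exp (y + y ^ 2), pow_nonneg (neg_nonneg.2 h) 3]
  · have := Real.quadratic_le_exp_of_nonneg (x := y + y ^ 2) (by positivity)
    have h3 : 1 ≤ (1 - y) * (1 + (y + y ^ 2) + (y + y ^ 2) ^ 2 / 2) := by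
      have : (1 - y) * (1 + (y + y ^ 2) + (y + y ^ 2) ^ 2 / 2) - 1 =
          y ^ 2 * (1 - y - y ^ 2 - y ^ 3) / 2 := by ring
      have h4 : 0 ≤ 1 - y - y ^ 2 - y ^ 3 := by nlinarith [mul_nonneg h h]
      nlinarith [mul_nonneg (sq_nonneg y) h4]
    nlinarith

lemma norm_inv_one_add_I_mul_line_le {b c u v κ : ℝ} (hb : b ^ 2 = 1) (hc : |c| ≤ 1 / 4)
    (hv : 0 ≤ v) (hκ : 0 ≤ κ) (hcκ : 2 * κ * c ^ 2 ≤ 1) (huv : 8 * κ * v = u ^ 2) :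
    ‖(1 + I * ((u : ℂ) + b * I) * c)⁻¹‖ ≤
      Real.exp (b * c + c ^ 2) * (1 + v) ^ (-(κ * c ^ 2)) := by
  have hy : |b * c| ≤ 1 / 4 := by
    have hb1 : |b| ≤ 1 := by rw [← sq_le_one_iff_abs_le_one, hb]
    calc |b * c| = |b| * |c| := abs_mul _ _
      _ ≤ 1 * (1 / 4) := by gcongr
      _ = 1 / 4 := one_mul _
  obtain ⟨h1, h2⟩ := abs_le.1 hy
  have hexp := exp_neg_add_sq_le_one_sub hy
  rw [mul_pow, hb, one_mul] at hexp
  have hpos : 0 < 1 + v := by linarith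
  have hbern : (1 + v) ^ (2 * κ * c ^ 2) ≤ 1 + 2 * κ * c ^ 2 * v :=
    rpow_one_add_le_one_add_mul_self (by linarith) (by positivity) hcκ
  have hsq : ((1 + v) ^ (κ * c ^ 2)) ^ 2 = (1 + v) ^ (2 * κ * c ^ 2) := by
    rw [← Real.rpow_mul_natCast hpos.le]; congr 1; push_cast; ring
  have hnorm : ‖1 + I * ((u : ℂ) + b * I) * c‖ ^ 2 = (1 - b * c) ^ 2 + (u * c) ^ 2 := by
    rw [one_add_I_mul_line, ← Complex.normSq_eq_norm_sq, Complex.normSq_apply]; simp; ring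
  have hlow : (1 - b * c) * (1 + v) ^ (κ * c ^ 2) ≤ ‖1 + I * ((u : ℂ) + b * I) * c‖ := by
    refine le_of_sq_le_sq ?_ (norm_nonneg _)
    rw [hnorm, mul_pow, hsq]
    have e : 2 * κ * c ^ 2 * v = (u * c) ^ 2 / 4 := by
      rw [mul_pow, ← huv]; ring
    rw [e] at hbern
    have h4 : (1 - b * c) ^ 2 ≤ 4 := by nlinarith
    nlinarith [mul_le_mul_of_nonneg_left hbern (sq_nonneg (1 - b * c)),
      mul_nonneg (sub_nonneg.2 h4) (sq_nonneg (u * c))]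
  have hp : 0 < (1 + v) ^ (κ * c ^ 2) := Real.rpow_pos_of_pos hpos _
  rw [norm_inv, Real.rpow_neg hpos.le]
  have : Real.exp (b * c + c ^ 2) * ((1 + v) ^ (κ * c ^ 2))⁻¹ =
      (Real.exp (-(b * c + c ^ 2)) * (1 + v) ^ (κ * c ^ 2))⁻¹ := by
    rw [Real.exp_neg, mul_inv, inv_inv]
  rw [this]
  refine inv_anti₀ (by positivity) (le_trans ?_ hlow)
  gcongr

lemma norm_prod_inv_one_add_I_mul_line_le {a : ι → ℝ} {b t τ : ℝ} (hb : b ^ 2 = 1)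
    (hbt : b * t = |t|) (hsum : ∑ k, a k = -t) (hsq : ∑ k, a k ^ 2 = 1 + τ) (hτ : 0 ≤ τ)
    (hτt : τ ≤ |t| / 2) (ha : ∀ k, |a k| ≤ 1 / 4) (κ : ℕ) (haκ : ∀ k, 2 * (κ + 1) * a k ^ 2 ≤ 1)
    (u : ℝ) :
    ‖∏ k, (1 + I * ((u : ℂ) + b * I) * a k)⁻¹‖ ≤
      Real.exp (1 - |t| / 2) * ((1 + u ^ 2 / (8 * (κ + 1))) ^ (κ + 1))⁻¹ := by
  have hv : 0 ≤ u ^ 2 / (8 * (κ + 1) : ℝ) := by positivity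
  have hpos : 0 < 1 + u ^ 2 / (8 * (κ + 1) : ℝ) := by positivity
  rw [norm_prod]
  refine (prod_le_prod (fun _ _ => norm_nonneg _) fun k _ =>
    norm_inv_one_add_I_mul_line_le (κ := κ + 1) hb (ha k) hv (by positivity) (haκ k)
      (by field_simp)).trans ?_
  rw [prod_mul_distrib, ← Real.exp_sum, ← Real.rpow_sum_of_pos hpos]
  rw [sum_add_distrib, ← mul_sum, hsum, hsq, sum_neg_distrib, ← mul_sum, hsq]
  have : ((1 + u ^ 2 / (8 * (κ + 1) : ℝ)) ^ (κ + 1))⁻¹ =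
      (1 + u ^ 2 / (8 * (κ + 1) : ℝ)) ^ (-(κ + 1 : ℝ)) := by
    rw [Real.rpow_neg hpos.le]
    congr 1
    exact_mod_cast (Real.rpow_natCast _ (κ + 1)).symm
  rw [this]
  gcongr
  · linarith
  · linarith
  · nlinarith [(κ.cast_nonneg : (0 : ℝ) ≤ κ)]

lemma norm_cexp_sub_cexp_le {p q : ℂ} {M : ℝ} (hp : ‖cexp p‖ ≤ M) (hq : ‖cexp q‖ ≤ M) :
    ‖cexp p - cexp q‖ ≤ M * ‖p - q‖ := by
  have hM : 0 < M := (norm_pos_iff.2 (Complex.exp_ne_zero p)).trans_le hp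
  have hmem : ∀ z : ℂ, ‖cexp z‖ ≤ M ↔ z.re ≤ Real.log M := fun z => by
    rw [Complex.norm_exp, Real.le_log_iff_exp_le hM]
  exact (convex_halfSpace_re_le (Real.log M)).norm_image_sub_le_of_norm_hasDerivWithin_le
    (fun z _ => (Complex.hasDerivAt_exp z).hasDerivWithinAt) (fun z hz => (hmem z).2 hz)
    ((hmem q).1 hq) ((hmem p).1 hp)

lemma norm_log_one_add_sub_le {z : ℂ} (hz : ‖z‖ ≤ 1 / 2) :
    ‖Complex.log (1 + z) - (z - z ^ 2 / 2)‖ ≤ ‖z‖ ^ 3 := by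
  have h := Complex.norm_log_sub_logTaylor_le 2 (z := z) (by linarith)
  have e : Complex.logTaylor (2 + 1) z = z - z ^ 2 / 2 := by
    simp [Complex.logTaylor, sum_range_succ]; ring
  rw [e] at h
  refine h.trans ?_
  have : (1 - ‖z‖)⁻¹ ≤ 2 := by
    rw [inv_le_comm₀ (by linarith) (by norm_num)]; linarith
  push_cast
  have h3 : 0 ≤ ‖z‖ ^ 3 := by positivity
  norm_num
  nlinarith

lemma norm_prod_inv_sub_cexp_le {a : ι → ℝ} {w : ℂ} {t τ M : ℝ} (hsum : ∑ k, a k = -t)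
    (hsq : ∑ k, a k ^ 2 = 1 + τ) (hτ : 0 ≤ τ) (hwa : ∀ k, ‖w‖ * |a k| ≤ 1 / 2)
    (hP : ‖∏ k, (1 + I * w * a k)⁻¹‖ ≤ M) (hG : ‖cexp (I * w * t - w ^ 2 / 2)‖ ≤ M) :
    ‖∏ k, (1 + I * w * a k)⁻¹ - cexp (I * w * t - w ^ 2 / 2)‖ ≤
      M * (‖w‖ ^ 3 * ∑ k, |a k| ^ 3 + ‖w‖ ^ 2 / 2 * τ) := by
  have hz : ∀ k, ‖I * w * a k‖ = ‖w‖ * |a k| := fun k => by simp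
  have hne : ∀ k, 1 + I * w * a k ≠ 0 := by
    intro k h
    have : I * w * a k = -1 := by linear_combination h
    have h2 := hz k
    rw [this, norm_neg, norm_one] at h2
    linarith [hwa k]
  have hprod : ∏ k, (1 + I * w * a k)⁻¹ = cexp (-∑ k, Complex.log (1 + I * w * a k)) := by
    rw [← sum_neg_distrib, Complex.exp_sum]
    refine prod_congr rfl fun k _ => ?_
    rw [Complex.exp_neg, Complex.exp_log (hne k)]
  rw [hprod] at hP ⊢
  refine (norm_cexp_sub_cexp_le hP hG).trans ?_
  have hM : 0 ≤ M := (norm_nonneg _).trans hP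
  gcongr
  have hsum' : ∑ k, (a k : ℂ) = -t := by exact_mod_cast hsum
  have hsq' : ∑ k, (a k : ℂ) ^ 2 = 1 + τ := by exact_mod_cast hsq
  have e : -∑ k, Complex.log (1 + I * w * a k) - (I * w * t - w ^ 2 / 2) =
      -(∑ k, (Complex.log (1 + I * w * a k) - (I * w * a k - (I * w * a k) ^ 2 / 2)))
      - w ^ 2 / 2 * τ := by
    have h1 : ∑ k, (I * w * a k - (I * w * a k) ^ 2 / 2) = -(I * w * t) + w ^ 2 / 2 * (1 + τ) := by
      have : ∀ k, I * w * a k - (I * w * a k) ^ 2 / 2 = I * w * a k + w ^ 2 / 2 * a k ^ 2 :=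
        fun k => by linear_combination (-w ^ 2 * a k ^ 2 / 2 : ℂ) * I_sq
      simp_rw [this]
      rw [sum_add_distrib, ← mul_sum, ← mul_sum, hsum', hsq']
      ring
    rw [sum_sub_distrib, h1]
    ring
  rw [e]
  refine (norm_sub_le _ _).trans (add_le_add ?_ ?_)
  · rw [norm_neg, mul_sum]
    refine (norm_sum_le _ _).trans (sum_le_sum fun k _ => ?_)
    refine (norm_log_one_add_sub_le (by rw [hz]; exact hwa k)).trans ?_
    rw [hz, mul_pow]
  · simp [abs_of_nonneg hτ]

lemma norm_pow_mul_prod_inv_sub_le {a : ι → ℝ} {b t τ δ L : ℝ} (hb : b ^ 2 = 1)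
    (hbt : b * t = |t|) (hsum : ∑ k, a k = -t) (hsq : ∑ k, a k ^ 2 = 1 + τ) (hτ : 0 ≤ τ)
    (hτt : τ ≤ |t| / 2) (hτL : τ ≤ t ^ 2 * L) (hcube : ∑ k, |a k| ^ 3 ≤ 4 * L * (1 + |t| ^ 3))
    (ha : ∀ k, |a k| ≤ 1 / 4) (hδ : 0 ≤ δ) (haδ : ∀ k, |a k| ≤ 2 * δ) (hδL : δ ^ 3 ≤ L)
    (r : ℕ) (har : ∀ k, 2 * (r + 4) * a k ^ 2 ≤ 1) (u : ℝ) :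
    ‖(-I * ((u : ℂ) + b * I)) ^ r * ∏ k, (1 + I * ((u : ℂ) + b * I) * a k)⁻¹ -
      (-I * ((u : ℂ) + b * I)) ^ r *
        cexp (I * ((u : ℂ) + b * I) * t - ((u : ℂ) + b * I) ^ 2 / 2)‖ ≤
      128 * L * (1 + |t|) ^ 3 * Real.exp (1 - |t| / 2) *
        ((16 * (r + 4)) ^ (r + 3) * (8 * (r + 4)) * (1 + u ^ 2)⁻¹) := by
  have hL : 0 ≤ L := (pow_nonneg hδ 3).trans hδL
  have hr3 : ((r + 3 : ℕ) : ℝ) + 1 = r + 4 := by push_cast; ring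
  set M := Real.exp (1 - |t| / 2) * ((1 + u ^ 2 / (8 * (r + 4))) ^ (r + 4))⁻¹ with hM
  have hM0 : 0 ≤ M := by positivity
  have hP := norm_prod_inv_one_add_I_mul_line_le hb hbt hsum hsq hτ hτt ha (r + 3)
    (by simpa only [hr3] using har) u
  have hG := norm_cexp_line_le hb hbt (r + 3) u
  have hW := two_add_abs_pow_mul_inv_le (r + 3) u
  simp only [hr3] at hP hG hW
  have hw := norm_line_le hb u
  generalize (u : ℂ) + b * I = w at *
  have hw2 : 1 + ‖w‖ ≤ 2 + |u| := by linarith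
  have hw0 := norm_nonneg w
  have ht0 := abs_nonneg t
  have key : ‖∏ k, (1 + I * w * a k)⁻¹ - cexp (I * w * t - w ^ 2 / 2)‖ ≤
      128 * L * (1 + |t|) ^ 3 * (1 + ‖w‖) ^ 3 * M := by
    rcases le_or_gt (‖w‖ * (2 * δ)) (1 / 2) with h | h
    · refine (norm_prod_inv_sub_cexp_le hsum hsq hτ (fun k => ?_) hP hG).trans ?_
      · exact (mul_le_mul_of_nonneg_left (haδ k) hw0).trans h
      · rw [mul_comm M]
        gcongr
        have h1 : ‖w‖ ^ 3 * ∑ k, |a k| ^ 3 ≤ (1 + ‖w‖) ^ 3 * (4 * L * (1 + |t|) ^ 3) := by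
          gcongr
          · linarith
          · refine hcube.trans ?_
            gcongr
            nlinarith [mul_nonneg ht0 ht0]
        have h2 : ‖w‖ ^ 2 / 2 * τ ≤ (1 + ‖w‖) ^ 3 * ((1 + |t|) ^ 3 * L) := by
          gcongr
          · nlinarith [mul_nonneg hw0 hw0, pow_nonneg hw0 3]
          · refine hτL.trans ?_
            gcongr
            rw [← sq_abs]
            nlinarith [mul_nonneg ht0 ht0, pow_nonneg ht0 3]
        have h3 : 0 ≤ L * (1 + |t|) ^ 3 * (1 + ‖w‖) ^ 3 := by positivity
        nlinarith
    · have h1 : ‖∏ k, (1 + I * w * a k)⁻¹ - cexp (I * w * t - w ^ 2 / 2)‖ ≤ 2 * M := by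
        refine (norm_sub_le _ _).trans ?_
        rw [two_mul]
        exact add_le_add hP hG
      have h2 : 1 ≤ 64 * (‖w‖ ^ 3 * L) := by
        have : 1 ≤ 4 * (‖w‖ * δ) := by linarith
        calc (1 : ℝ) ≤ (4 * (‖w‖ * δ)) ^ 3 := one_le_pow₀ this
          _ = 64 * (‖w‖ ^ 3 * δ ^ 3) := by ring
          _ ≤ _ := by gcongr
      have h3 : ‖w‖ ^ 3 * L ≤ L * (1 + |t|) ^ 3 * (1 + ‖w‖) ^ 3 := by
        have e1 : 1 ≤ (1 + |t|) ^ 3 := one_le_pow₀ (by linarith)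
        have e2 : ‖w‖ ^ 3 ≤ (1 + ‖w‖) ^ 3 := by gcongr; linarith
        calc ‖w‖ ^ 3 * L ≤ (1 + ‖w‖) ^ 3 * L := by gcongr
          _ ≤ (1 + ‖w‖) ^ 3 * L * (1 + |t|) ^ 3 := le_mul_of_one_le_right (by positivity) e1
          _ = _ := by ring
      refine h1.trans ?_
      gcongr
      nlinarith
  rw [← mul_sub, norm_mul, norm_pow, norm_mul, norm_neg, norm_I, one_mul]
  calc _ ≤ (2 + |u|) ^ r * (128 * L * (1 + |t|) ^ 3 * (2 + |u|) ^ 3 * M) := by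
        refine mul_le_mul (by gcongr; linarith) (key.trans ?_) (norm_nonneg _) (by positivity)
        gcongr
    _ = 128 * L * (1 + |t|) ^ 3 * Real.exp (1 - |t| / 2) *
        ((2 + |u|) ^ (r + 3) * ((1 + u ^ 2 / (8 * (r + 4))) ^ (r + 4))⁻¹) := by
        rw [hM]; ring
    _ ≤ _ := mul_le_mul_of_nonneg_left hW (by positivity)

lemma abs_hermiteFun_sub_sum_truncatedPower_le [DecidableEq ι]
    {a : ι → ℝ} (hinj : Function.Injective a)
    {m r : ℕ} (hcard : m + r + 2 = Fintype.card ι) (hm : m ≠ 0) {t τ δ L : ℝ}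
    (hsum : ∑ k, a k = -t) (hsq : ∑ k, a k ^ 2 = 1 + τ) (hτ : 0 ≤ τ)
    (hτt : τ ≤ |t| / 2) (hτL : τ ≤ t ^ 2 * L) (hcube : ∑ k, |a k| ^ 3 ≤ 4 * L * (1 + |t| ^ 3))
    (ha : ∀ k, |a k| ≤ 1 / 4) (hδ : 0 ≤ δ) (haδ : ∀ k, |a k| ≤ 2 * δ) (hδL : δ ^ 3 ≤ L)
    (har : ∀ k, 2 * (r + 4) * a k ^ 2 ≤ 1) :
    |hermiteFun r t - ∑ k, max (a k) 0 ^ m / ∏ j ∈ univ.erase k, (a k - a j)| ≤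
      128 * L * (1 + |t|) ^ 3 * Real.exp (1 - |t| / 2) *
        ((16 * (r + 4)) ^ (r + 3) * (8 * (r + 4))) := by
  obtain ⟨b, hb, hbt⟩ := exists_sign_mul_eq_abs t
  obtain ⟨hi, he⟩ := integral_prod_inv_eq_sum_truncatedPower hinj hcard hm hb ha
  have h := norm_integral_le_of_norm_le
    ((integrable_inv_one_add_sq.const_mul ((16 * (r + 4)) ^ (r + 3) * (8 * (r + 4) : ℝ))).const_mul
      (128 * L * (1 + |t|) ^ 3 * Real.exp (1 - |t| / 2)))
    (Eventually.of_forall fun u =>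
      norm_pow_mul_prod_inv_sub_le hb hbt hsum hsq hτ hτt hτL hcube ha hδ haδ hδL r har u)
  rw [integral_sub hi (integrable_pow_mul_cexp_line hb hbt r), he,
    integral_pow_mul_cexp_line hb hbt, integral_const_mul, integral_const_mul,
    integral_univ_inv_one_add_sq, ← mul_sub, norm_mul, norm_mul, ← Complex.ofReal_sub, norm_real,
    norm_real, Real.norm_eq_abs, Real.norm_eq_abs, abs_of_pos Real.pi_pos, Complex.norm_ofNat,
    abs_sub_comm] at h
  have hL : 0 ≤ L := (pow_nonneg hδ 3).trans hδL
  have hX : 0 ≤ 128 * L * (1 + |t|) ^ 3 * Real.exp (1 - |t| / 2) *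
        ((16 * (r + 4)) ^ (r + 3) * (8 * (r + 4))) := by positivity
  nlinarith [Real.pi_pos]

end

lemma one_add_abs_pow_mul_exp_le (k : ℕ) (t : ℝ) :
    (1 + |t|) ^ k * Real.exp (-(|t| / 2)) ≤ 2 ^ k * k.factorial * Real.exp (1 / 2) := by
  have h := Real.pow_div_factorial_le_exp ((1 + |t|) / 2) (by positivity) k
  rw [div_le_iff₀ (by positivity), div_pow, div_le_iff₀ (by positivity)] at h
  calc (1 + |t|) ^ k * Real.exp (-(|t| / 2))
      ≤ Real.exp ((1 + |t|) / 2) * k.factorial * 2 ^ k * Real.exp (-(|t| / 2)) := by gcongr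
    _ = 2 ^ k * k.factorial * (Real.exp ((1 + |t|) / 2) * Real.exp (-(|t| / 2))) := by ring
    _ = _ := by rw [← Real.exp_add]; congr 2; ring

lemma abs_pow_mul_exp_le (k : ℕ) (t : ℝ) :
    |t| ^ k * Real.exp (-(|t| / 2)) ≤ 2 ^ k * k.factorial * Real.exp (1 / 2) := by
  refine le_trans ?_ (one_add_abs_pow_mul_exp_le k t)
  gcongr
  linarith

lemma abs_add_pow_three_le (x y : ℝ) : |x + y| ^ 3 ≤ 4 * (|x| ^ 3 + |y| ^ 3) := by
  have h := abs_add_le x y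
  have hx := abs_nonneg x
  have hy := abs_nonneg y
  calc |x + y| ^ 3 ≤ (|x| + |y|) ^ 3 := by gcongr
    _ ≤ _ := by nlinarith [mul_nonneg (add_nonneg hx hy) (sq_nonneg (|x| - |y|))]

lemma one_le_card_mul_sum_abs_cube_sq {ι : Type*} [Fintype ι] {x : ι → ℝ}
    (h2 : ∑ k, x k ^ 2 = 1) :
    1 ≤ (Fintype.card ι : ℝ) * (∑ k, |x k| ^ 3) ^ 2 := by
  have hL : 0 ≤ ∑ k, |x k| ^ 3 := sum_nonneg fun k _ => by positivity
  have h1 : (∑ k, |x k|) ^ 2 ≤ Fintype.card ι := by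
    have := sq_sum_le_card_mul_sum_sq (s := univ) (f := fun k => |x k|)
    simpa [h2] using this
  have h3 : (∑ k, x k ^ 2) ^ 2 ≤ (∑ k, |x k|) * ∑ k, |x k| ^ 3 := by
    refine sum_sq_le_sum_mul_sum_of_sq_le_mul univ (fun k _ => abs_nonneg _)
      (fun k _ => by positivity) fun k _ => le_of_eq ?_
    rw [← sq_abs (x k)]
    ring
  rw [h2, one_pow] at h3
  calc (1 : ℝ) ≤ ((∑ k, |x k|) * ∑ k, |x k| ^ 3) ^ 2 := one_le_pow₀ h3
    _ = (∑ k, |x k|) ^ 2 * (∑ k, |x k| ^ 3) ^ 2 := mul_pow _ _ _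
    _ ≤ _ := by gcongr

/-- The divided difference at the nodes `x` of the truncated power `y ↦ (y - t / n)_+ ^ m`. -/
noncomputable def truncatedPowerDividedDifference {n : ℕ} (x : Fin n → ℝ) (m : ℕ) (t : ℝ) : ℝ :=
  ∑ k, max (x k - t / n) 0 ^ m / ∏ j ∈ univ.erase k, (x k - x j)

lemma truncatedPowerDividedDifference_eq_zero {n m : ℕ} {x : Fin n → ℝ}
    (hx : Function.Injective x) (hm : m ≠ 0) (hmn : m + 1 < n) {δ t : ℝ} (hδ : ∀ k, |x k| ≤ δ)
    (ht : n * δ < |t|) : truncatedPowerDividedDifference x m t = 0 := by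
  have hn : (0 : ℝ) < n := by exact_mod_cast (by omega : 0 < n)
  have ht' : δ < |t / n| := by rwa [abs_div, Nat.abs_cast, lt_div_iff₀' hn]
  rcases lt_abs.1 ht' with h | h
  · refine sum_eq_zero fun k _ => ?_
    have := (abs_le.1 (hδ k)).2
    rw [max_eq_right (by linarith), zero_pow hm, zero_div]
  · have hpos : ∀ k, 0 ≤ x k - t / n := fun k => by
      have := (abs_le.1 (hδ k)).1
      linarith
    have hinj : Function.Injective fun k => x k - t / n := fun i j hij => hx (by simpa using hij)
    have hdeg : (Polynomial.X ^ m : Polynomial ℝ).degree < #(univ : Finset (Fin n)) := by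
      rw [Polynomial.degree_X_pow, card_univ, Fintype.card_fin]
      exact_mod_cast (by omega : m < n)
    have := Lagrange.coeff_eq_sum hinj.injOn hdeg
    rw [Polynomial.coeff_X_pow, if_neg (by rw [card_univ, Fintype.card_fin]; omega)] at this
    rw [truncatedPowerDividedDifference]
    refine (sum_congr rfl fun k _ => ?_).trans this.symm
    rw [max_eq_left (hpos k)]
    simp

lemma abs_hermiteFun_sub_truncatedPowerDividedDifference_le {n m r : ℕ} (hm : m ≠ 0)
    (hmn : m + r + 2 = n) {x : Fin n → ℝ} (hx : Function.Injective x) (h1 : ∑ k, x k = 0)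
    (h2 : ∑ k, x k ^ 2 = 1) {L δ t : ℝ} (h3 : ∑ k, |x k| ^ 3 ≤ L) (hnL : 1 / (n : ℝ) ≤ L)
    (hxδ : ∀ k, |x k| ≤ δ) (hδ0 : 0 ≤ δ) (hδ : 8 * (r + 4) * δ ≤ 1) (hδL : δ ^ 3 ≤ L)
    (ht : |t| ≤ n * δ) :
    |hermiteFun r t - truncatedPowerDividedDifference x m t| ≤
      128 * L * (1 + |t|) ^ 3 * Real.exp (1 - |t| / 2) *
        ((16 * (r + 4)) ^ (r + 3) * (8 * (r + 4))) := by
  have hn : (0 : ℝ) < n := by exact_mod_cast (by omega : 0 < n)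
  have hn1 : (1 : ℝ) ≤ n := by exact_mod_cast (by omega : 1 ≤ n)
  have hrδ : 0 ≤ (r : ℝ) * δ := by positivity
  have hδ1 : δ ≤ 1 / 8 := by linarith
  have htn : |t / n| ≤ δ := by rwa [abs_div, Nat.abs_cast, div_le_iff₀' hn]
  have haδ : ∀ k, |x k - t / n| ≤ 2 * δ := fun k => by
    have h4 := hxδ k
    have := abs_sub (x k) (t / n)
    linarith
  have hsum : ∑ k, (x k - t / n) = -t := by
    rw [sum_sub_distrib, h1, sum_const, card_univ, Fintype.card_fin, nsmul_eq_mul]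
    field_simp
    ring
  have hsq : ∑ k, (x k - t / n) ^ 2 = 1 + t ^ 2 / n := by
    have : ∀ k, (x k - t / n) ^ 2 = x k ^ 2 - 2 * (t / n) * x k + (t / n) ^ 2 :=
      fun k => by ring
    simp_rw [this]
    rw [sum_add_distrib, sum_sub_distrib, ← mul_sum, h1, h2, sum_const, card_univ,
      Fintype.card_fin, nsmul_eq_mul]
    field_simp
    ring
  have hτt : t ^ 2 / n ≤ |t| / 2 := by
    have : t ^ 2 / n = |t| * |t / n| := by
      rw [abs_div, Nat.abs_cast, ← sq_abs]; ring
    rw [this]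
    nlinarith [mul_le_mul_of_nonneg_left (htn.trans hδ1) (abs_nonneg t)]
  have hτL : t ^ 2 / n ≤ t ^ 2 * L := by
    rw [div_eq_mul_one_div]
    gcongr
  have hcube : ∑ k, |x k - t / n| ^ 3 ≤ 4 * L * (1 + |t| ^ 3) := by
    have h4 : ∀ k, |x k - t / n| ^ 3 ≤ 4 * (|x k| ^ 3 + |t / n| ^ 3) := fun k => by
      simpa [sub_eq_add_neg] using abs_add_pow_three_le (x k) (-(t / n))
    refine (sum_le_sum fun k _ => h4 k).trans ?_
    rw [← mul_sum, sum_add_distrib, sum_const, card_univ, Fintype.card_fin, nsmul_eq_mul]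
    have h5 : (n : ℝ) * |t / n| ^ 3 = |t| ^ 3 * (1 / n * (1 / n)) := by
      rw [abs_div, Nat.abs_cast]
      field_simp
    have h6 : 1 / (n : ℝ) * (1 / n) ≤ L := by
      have h7 : 1 / (n : ℝ) ≤ 1 := by rw [div_le_one hn]; exact hn1
      exact (mul_le_of_le_one_left (by positivity) h7).trans hnL
    rw [h5]
    nlinarith [mul_le_mul_of_nonneg_left h6 (pow_nonneg (abs_nonneg t) 3)]
  have har : ∀ k, 2 * (r + 4) * (x k - t / n) ^ 2 ≤ 1 := fun k => by
    calc 2 * (r + 4 : ℝ) * (x k - t / n) ^ 2 ≤ 2 * (r + 4) * (2 * δ) ^ 2 := by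
          rw [← sq_abs (x k - t / n)]
          gcongr
          exact haδ k
      _ = 8 * (r + 4) * δ * δ := by ring
      _ ≤ 1 * 1 := by gcongr; linarith
      _ = 1 := one_mul 1
  have h := abs_hermiteFun_sub_sum_truncatedPower_le (a := fun k => x k - t / n)
    (fun i j hij => hx (by simpa using hij)) (by rw [Fintype.card_fin]; exact hmn) hm hsum hsq
    (by positivity) hτt hτL hcube (fun k => (haδ k).trans (by linarith)) hδ0 haδ hδL har
  simp only [sub_sub_sub_cancel_right] at h
  exact h

lemma abs_pow_mul_hermiteFun_le {r n : ℕ} {C L δ t : ℝ} (hC : 0 ≤ C) (hδ0 : 0 ≤ δ)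
    (hL0 : 0 ≤ L) (hnL : 1 ≤ n * L ^ 2) (hnδ : 1 ≤ n * δ ^ 2) (ht : n * δ < |t|) (p : ℕ)
    (hH : |hermiteFun r t| ≤ C * Real.exp (-(|t| / 2))) :
    |t| ^ p * |hermiteFun r t| ≤
      C * (2 ^ (p + 1) * (p + 1).factorial * Real.exp (1 / 2)) * L := by
  have ht2 : (n : ℝ) ≤ |t| ^ 2 := by
    calc (n : ℝ) ≤ n * (n * δ ^ 2) := le_mul_of_one_le_right n.cast_nonneg hnδ
      _ = (n * δ) ^ 2 := by ring
      _ ≤ _ := by gcongr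
  have hLt : 1 ≤ L * |t| := by
    refine le_of_sq_le_sq ?_ (by positivity)
    calc (1 : ℝ) ^ 2 ≤ n * L ^ 2 := by simpa using hnL
      _ ≤ |t| ^ 2 * L ^ 2 := by gcongr
      _ = _ := by ring
  calc |t| ^ p * |hermiteFun r t|
      ≤ |t| ^ p * (C * Real.exp (-(|t| / 2))) := by gcongr
    _ ≤ |t| ^ p * (C * Real.exp (-(|t| / 2))) * (L * |t|) :=
        le_mul_of_one_le_right (by positivity) hLt
    _ = C * (|t| ^ (p + 1) * Real.exp (-(|t| / 2))) * L := by ring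
    _ ≤ _ := mul_le_mul_of_nonneg_right
        (mul_le_mul_of_nonneg_left (abs_pow_mul_exp_le (p + 1) t) hC) hL0

lemma one_div_card_le {n : ℕ} {L : ℝ} (hn : (0 : ℝ) < n) (hL0 : 0 ≤ L) (hL1 : L ≤ 1)
    (hnL : 1 ≤ n * L ^ 2) : 1 / (n : ℝ) ≤ L := by
  rw [div_le_iff₀' hn]
  refine hnL.trans ?_
  gcongr
  exact pow_le_of_le_one hL0 hL1 two_ne_zero

/-- Weighted uniform estimate between the divided difference and the Hermite function, without
derivatives. -/
lemma exists_abs_pow_mul_hermiteFun_sub_le (p r : ℕ) :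
    ∃ C > (0 : ℝ), ∃ ε > (0 : ℝ), ε ≤ 1 ∧ ∀ n m : ℕ, m ≠ 0 → m + r + 2 = n →
      ∀ x : Fin n → ℝ, Function.Injective x →
        (∑ k, x k) = 0 → (∑ k, (x k) ^ 2) = 1 → (∑ k, |x k| ^ 3) ≤ ε →
        ∀ t : ℝ, |t| ^ p * |hermiteFun r t - truncatedPowerDividedDifference x m t| ≤
          C * ∑ k, |x k| ^ 3 := by
  obtain ⟨CH, hCH, hH⟩ := abs_hermiteFun_le r
  let D : ℝ := 128 * Real.exp 1 * ((16 * (r + 4)) ^ (r + 3) * (8 * (r + 4)))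
  let A : ℝ := 2 ^ (p + 3) * (p + 3).factorial * Real.exp (1 / 2)
  let B : ℝ := 2 ^ (p + 1) * (p + 1).factorial * Real.exp (1 / 2)
  have hD : D = 128 * Real.exp 1 * ((16 * (r + 4)) ^ (r + 3) * (8 * (r + 4))) := rfl
  have hD0 : 0 ≤ D := by positivity
  have hA0 : 0 ≤ A := by positivity
  have hB0 : 0 < B := by positivity
  have hA : ∀ t : ℝ, (1 + |t|) ^ (p + 3) * Real.exp (-(|t| / 2)) ≤ A :=
    one_add_abs_pow_mul_exp_le (p + 3)
  have hB : ∀ {n : ℕ} {L δ t : ℝ}, 0 ≤ δ → 0 ≤ L → 1 ≤ n * L ^ 2 → 1 ≤ n * δ ^ 2 → n * δ < |t| →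
      |t| ^ p * |hermiteFun r t| ≤ CH * B * L := fun h1 h2 h3 h4 h5 =>
    abs_pow_mul_hermiteFun_le hCH.le h1 h2 h3 h4 h5 p (hH _)
  clear_value D A B
  let η : ℝ := (8 * (r + 4))⁻¹
  have hη0 : 0 < η := by positivity
  have hη : 8 * (r + 4) * η = 1 := mul_inv_cancel₀ (by positivity)
  clear_value η
  have hη1 : η ≤ 1 := by
    have : 0 ≤ (r : ℝ) * η := by positivity
    linarith
  refine ⟨D * A + CH * B, by positivity, η ^ 3, by positivity, pow_le_one₀ hη0.le hη1, ?_⟩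
  intro n m hm hmn x hx h1 h2 h3 t
  have hn : (0 : ℝ) < n := by exact_mod_cast (by omega : 0 < n)
  have hnL : 1 ≤ n * (∑ k, |x k| ^ 3) ^ 2 := by simpa using one_le_card_mul_sum_abs_cube_sq h2
  have : Nonempty (Fin n) := ⟨⟨0, by omega⟩⟩
  obtain ⟨k₀, hk₀⟩ := Finite.exists_max fun k => |x k|
  have hδL : |x k₀| ^ 3 ≤ ∑ k, |x k| ^ 3 :=
    single_le_sum (f := fun k => |x k| ^ 3) (fun k _ => by positivity) (mem_univ k₀)
  have hL0 : 0 ≤ ∑ k, |x k| ^ 3 := sum_nonneg fun k _ => by positivity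
  have hδ0 : 0 ≤ |x k₀| := abs_nonneg _
  have hL3 := le_refl (∑ k, |x k| ^ 3)
  generalize |x k₀| = δ at *
  generalize hL : ∑ k, |x k| ^ 3 = L at *
  have hnL' := one_div_card_le hn hL0 (h3.trans (pow_le_one₀ hη0.le hη1)) hnL
  have hδη : δ ≤ η := (pow_le_pow_iff_left₀ hδ0 hη0.le three_ne_zero).1 (hδL.trans h3)
  rcases le_or_gt |t| (n * δ) with ht | ht
  · have hδ : 8 * (r + 4) * δ ≤ 1 := hη ▸ by gcongr
    have h := abs_hermiteFun_sub_truncatedPowerDividedDifference_le hm hmn hx h1 h2 hL.le hnL' hk₀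
      hδ0 hδ hδL ht
    calc |t| ^ p * |hermiteFun r t - truncatedPowerDividedDifference x m t|
        ≤ (1 + |t|) ^ p * (128 * L * (1 + |t|) ^ 3 * Real.exp (1 - |t| / 2) *
        ((16 * (r + 4)) ^ (r + 3) * (8 * (r + 4)))) :=
          mul_le_mul (pow_le_pow_left₀ (abs_nonneg t) (by linarith) p) h (abs_nonneg _)
            (by positivity)
      _ = D * ((1 + |t|) ^ (p + 3) * Real.exp (-(|t| / 2))) * L := by
          rw [hD, sub_eq_add_neg, Real.exp_add, pow_add (1 + |t|)]; ring
      _ ≤ D * A * L := by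
          gcongr
          exact hA t
      _ ≤ (D * A + CH * B) * L := by
          gcongr
          exact le_add_of_nonneg_right (by positivity)
  · rw [truncatedPowerDividedDifference_eq_zero hx hm (by omega) hk₀ ht, sub_zero]
    have hnδ : 1 ≤ n * δ ^ 2 := by
      rw [← h2]
      have : ∀ k ∈ univ, x k ^ 2 ≤ δ ^ 2 := fun k _ => by
        rw [← sq_abs]; exact pow_le_pow_left₀ (abs_nonneg _) (hk₀ k) 2
      simpa using sum_le_card_nsmul univ _ _ this
    refine (hB hδ0 hL0 hnL hnδ ht).trans ?_
    gcongr
    exact le_add_of_nonneg_left (by positivity)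

lemma hasDerivAt_hermiteFun (r : ℕ) (t : ℝ) :
    HasDerivAt (hermiteFun r) (-hermiteFun (r + 1) t) t := by
  have h1 := ((Polynomial.hermite r).map (Int.castRingHom ℝ)).hasDerivAt t
  have h2 : HasDerivAt (fun s : ℝ => Real.exp (-s ^ 2 / 2)) (Real.exp (-t ^ 2 / 2) * (-t)) t := by
    have := (((hasDerivAt_id t).pow 2).neg.div_const 2).exp
    refine this.congr_deriv ?_
    simp
    ring
  refine ((h1.const_mul (1 / Real.sqrt (2 * π))).mul h2).congr_deriv ?_
  simp only [hermiteFun, Polynomial.hermite_succ, Polynomial.map_sub, Polynomial.map_mul,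
    Polynomial.map_X, Polynomial.eval_sub, Polynomial.eval_mul, Polynomial.eval_X,
    Polynomial.derivative_map]
  ring

lemma hasDerivAt_max_zero_pow {m : ℕ} (hm : m ≠ 0) (y : ℝ) :
    HasDerivAt (fun y : ℝ => max y 0 ^ (m + 1)) ((m + 1) * max y 0 ^ m) y := by
  have hpow : ∀ y : ℝ, HasDerivAt (fun y : ℝ => y ^ (m + 1)) ((m + 1) * y ^ m) y := fun y => by
    simpa using hasDerivAt_pow (m + 1) y
  rcases lt_trichotomy y 0 with h | h | h
  · rw [max_eq_right h.le, zero_pow hm, mul_zero]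
    refine (hasDerivAt_const y (0 : ℝ)).congr_of_eventuallyEq ?_
    filter_upwards [eventually_lt_nhds h] with z hz
    rw [max_eq_right hz.le, zero_pow m.succ_ne_zero]
  · subst h
    rw [max_self, zero_pow hm, mul_zero, ← hasDerivWithinAt_univ, ← Set.Iic_union_Ici (a := (0 : ℝ))]
    refine HasDerivWithinAt.union ?_ ?_
    · refine (hasDerivWithinAt_const (0 : ℝ) _ (0 : ℝ)).congr (fun z hz => ?_) (by simp)
      rw [max_eq_right hz, zero_pow m.succ_ne_zero]
    · have := (hpow 0).hasDerivWithinAt (s := Set.Ici 0)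
      rw [zero_pow hm, mul_zero] at this
      refine this.congr (fun z hz => ?_) (by simp)
      rw [max_eq_left hz]
  · rw [max_eq_left h.le]
    refine (hpow y).congr_of_eventuallyEq ?_
    filter_upwards [eventually_gt_nhds h] with z hz
    rw [max_eq_left hz.le]

lemma hasDerivAt_truncatedPowerDividedDifference {n : ℕ} (x : Fin n → ℝ) {m : ℕ} (hm : m ≠ 0)
    (t : ℝ) : HasDerivAt (truncatedPowerDividedDifference x (m + 1))
      (-((m + 1) / n * truncatedPowerDividedDifference x m t)) t := by
  have h : ∀ k ∈ univ, HasDerivAt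
      (fun t : ℝ => max (x k - t / n) 0 ^ (m + 1) / ∏ j ∈ univ.erase k, (x k - x j))
      ((m + 1) * max (x k - t / n) 0 ^ m * (-(1 / n)) / ∏ j ∈ univ.erase k, (x k - x j)) t :=
    fun k _ => ((hasDerivAt_max_zero_pow hm (x k - t / n)).comp t
      (((hasDerivAt_id t).div_const (n : ℝ)).const_sub (x k))).div_const _
  refine (HasDerivAt.fun_sum h).congr_deriv ?_
  rw [truncatedPowerDividedDifference, mul_sum, ← sum_neg_distrib]
  exact sum_congr rfl fun k _ => by ring

lemma iteratedDeriv_hermiteFun_sub {n : ℕ} (x : Fin n → ℝ) (q r : ℕ) {m : ℕ} (hm : m ≠ 0) :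
    iteratedDeriv q (fun t => hermiteFun r t - truncatedPowerDividedDifference x (m + q) t) =
      fun t => (-1) ^ q * (hermiteFun (r + q) t -
        (m + q).descFactorial q / (n : ℝ) ^ q * truncatedPowerDividedDifference x m t) := by
  induction q generalizing m with
  | zero => simp
  | succ q ih =>
    have e : m + (q + 1) = m + 1 + q := by ring
    rw [iteratedDeriv_succ, e, ih m.succ_ne_zero]
    funext t
    have hd := ((hasDerivAt_hermiteFun (r + q) t).sub
      ((hasDerivAt_truncatedPowerDividedDifference x hm t).const_mul
        (((m + 1 + q).descFactorial q : ℝ) / (n : ℝ) ^ q))).const_mul ((-1) ^ q)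
    refine hd.deriv.trans ?_
    rw [Nat.descFactorial_succ, Nat.add_sub_cancel, ← add_assoc r]
    push_cast
    ring

lemma one_sub_le_descFactorial_div_pow {n m q r : ℕ} (h : m + q + r + 2 = n) :
    1 - q * (q + r + 1 : ℝ) * (1 / n) ≤ (m + q).descFactorial q / (n : ℝ) ^ q := by
  have hn : (0 : ℝ) < n := by exact_mod_cast (by omega : 0 < n)
  have h1 := Nat.pow_sub_le_descFactorial (m + q) q
  rw [show m + q + 1 - q = m + 1 by omega] at h1
  have h2 : ((m + 1 : ℕ) : ℝ) ^ q ≤ (m + q).descFactorial q := by exact_mod_cast h1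
  have hm : ((m + 1 : ℕ) : ℝ) = n * (1 + -((q + r + 1) / n)) := by
    have : (m + q + r + 2 : ℝ) = n := by exact_mod_cast h
    push_cast
    field_simp
    linarith
  rw [le_div_iff₀ (by positivity)]
  refine le_trans ?_ h2
  have h3 : (q + r + 1 : ℝ) / n ≤ 1 := by
    rw [div_le_one hn]; exact_mod_cast (by omega : q + r + 1 ≤ n)
  have h4 := one_add_mul_le_pow (a := -((q + r + 1 : ℝ) / n)) (by linarith) q
  rw [hm, mul_pow, mul_comm]
  gcongr
  refine le_trans (le_of_eq ?_) h4
  ring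

lemma descFactorial_div_pow_le_one {n N q : ℕ} (h : N ≤ n) :
    (N.descFactorial q : ℝ) / (n : ℝ) ^ q ≤ 1 := by
  refine div_le_one_of_le₀ ?_ (by positivity)
  exact_mod_cast (Nat.descFactorial_le_pow N q).trans (Nat.pow_le_pow_left h q)

/-- Derivatives of B-splines approximate Hermite functions in every Schwartz seminorm.
`Polynomial.hermite r` is the `r`-th probabilists' Hermite polynomial. -/
theorem bspline_hermite_schwartz (p q r : ℕ) :
    ∃ C > (0 : ℝ), ∃ ε > (0 : ℝ), ∃ N : ℕ, ∀ n : ℕ, N ≤ n →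
      ∀ x : Fin n → ℝ, StrictMono x →
        (∑ k, x k) = 0 → (∑ k, (x k) ^ 2) = 1 → (∑ k, |x k| ^ 3) ≤ ε →
        ∀ t : ℝ,
          |t ^ p *
            iteratedDeriv q
              (fun s : ℝ =>
                (1 / Real.sqrt (2 * π)) *
                    ((Polynomial.hermite r).map (Int.castRingHom ℝ)).eval s *
                    Real.exp (-s ^ 2 / 2) -
                  ∑ k, (max (x k - s / n) 0) ^ (n - 2 - r) /
                    ∏ j ∈ univ.erase k, (x k - x j)) t|
            ≤ C * ∑ k, |x k| ^ 3 := by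
  obtain ⟨C, hC, ε, hε, hε1, hmain⟩ := exists_abs_pow_mul_hermiteFun_sub_le p (r + q)
  obtain ⟨CH, hCH, hH⟩ := abs_hermiteFun_le (r + q)
  set B : ℝ := 2 ^ p * p.factorial * Real.exp (1 / 2) with hB
  refine ⟨C + q * (q + r + 1) * (CH * B), by positivity, ε, hε, r + q + 3, ?_⟩
  intro n hn x hx h1 h2 h3 t
  obtain ⟨m, hm, hmn⟩ : ∃ m, m ≠ 0 ∧ m + q + r + 2 = n := ⟨n - (q + r + 2), by omega, by omega⟩
  have hexp : n - 2 - r = m + q := by omega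
  have hn0 : (0 : ℝ) < n := by exact_mod_cast (by omega : 0 < n)
  set L := ∑ k, |x k| ^ 3 with hL
  have hL0 : 0 ≤ L := sum_nonneg fun k _ => by positivity
  have hnL : 1 / (n : ℝ) ≤ L := by
    have : 1 ≤ n * L ^ 2 := by simpa using one_le_card_mul_sum_abs_cube_sq h2
    exact one_div_card_le hn0 hL0 (h3.trans hε1) this
  have hderiv := congrFun (iteratedDeriv_hermiteFun_sub x q r hm) t
  rw [← hexp] at hderiv
  unfold hermiteFun truncatedPowerDividedDifference at hderiv
  rw [hderiv]
  change |t ^ p * ((-1) ^ q * (hermiteFun (r + q) t -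
    (n - 2 - r).descFactorial q / (n : ℝ) ^ q * truncatedPowerDividedDifference x m t))| ≤ _
  rw [hexp]
  have hc1 := one_sub_le_descFactorial_div_pow hmn
  have hc2 : ((m + q).descFactorial q : ℝ) / (n : ℝ) ^ q ≤ 1 :=
    descFactorial_div_pow_le_one (by omega)
  have hc0 : 0 ≤ ((m + q).descFactorial q : ℝ) / (n : ℝ) ^ q := by positivity
  set c := ((m + q).descFactorial q : ℝ) / (n : ℝ) ^ q
  have hT := hmain n m hm (by omega) x hx.injective h1 h2 h3 t
  have hHt : |t| ^ p * |hermiteFun (r + q) t| ≤ CH * B := by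
    calc |t| ^ p * |hermiteFun (r + q) t|
        ≤ |t| ^ p * (CH * Real.exp (-(|t| / 2))) := by gcongr; exact hH t
      _ = CH * (|t| ^ p * Real.exp (-(|t| / 2))) := by ring
      _ ≤ _ := by gcongr; exact abs_pow_mul_exp_le p t
  have hsplit : hermiteFun (r + q) t - c * truncatedPowerDividedDifference x m t =
      c * (hermiteFun (r + q) t - truncatedPowerDividedDifference x m t) +
        (1 - c) * hermiteFun (r + q) t := by ring
  rw [abs_mul, abs_mul, abs_pow, abs_pow, abs_neg, abs_one, one_pow, one_mul, hsplit]
  calc |t| ^ p * |c * (hermiteFun (r + q) t - truncatedPowerDividedDifference x m t) +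
        (1 - c) * hermiteFun (r + q) t|
      ≤ |t| ^ p * (c * |hermiteFun (r + q) t - truncatedPowerDividedDifference x m t| +
        (1 - c) * |hermiteFun (r + q) t|) := by
        gcongr
        refine (abs_add_le _ _).trans ?_
        rw [abs_mul, abs_mul, abs_of_nonneg hc0, abs_of_nonneg (sub_nonneg.2 hc2)]
    _ = c * (|t| ^ p * |hermiteFun (r + q) t - truncatedPowerDividedDifference x m t|) +
        (1 - c) * (|t| ^ p * |hermiteFun (r + q) t|) := by ring
    _ ≤ 1 * (C * L) + (q * (q + r + 1) * L) * (CH * B) := by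
        gcongr
        calc 1 - c ≤ q * (q + r + 1 : ℝ) * (1 / n) := by linarith
          _ ≤ _ := by gcongr
    _ = _ := by ring
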